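/- arXiv:1506.01498 — 4 statements merged into one kernel-verified Lean document; each statement's English description precedes it below -/
import Mathlib

section
/- The q-binomial theorem: for any commutative ring element t, any q, and any natural number u, the product over i from 0 to u-1 of (1 + q^i * t) equals the sum over i from 0 to u of q^(binomial(i,2)) * (Gaussian binomial coefficient u choose i with parameter q) * t^i. -/
open Finset

/-- The Gaussian (q-)binomial coefficient, defined via the q-Pascal recurrence
`(u+1 choose i+1)_q = (u choose i)_q + q^(i+1) * (u choose i+1)_q`. -/
def gaussBinom {R : Type*} [CommRing R] (q : R) : ℕ → ℕ → R
  | _, 0 => 1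
  | 0, _ + 1 => 0
  | u + 1, i + 1 => gaussBinom q u i + q ^ (i + 1) * gaussBinom q u (i + 1)

theorem gaussBinom_zero_right {R : Type*} [CommRing R] (q : R) (u : ℕ) :
    gaussBinom q u 0 = 1 := by
  cases u <;> rfl

theorem gaussBinom_succ_succ {R : Type*} [CommRing R] (q : R) (u i : ℕ) :
    gaussBinom q (u + 1) (i + 1) = gaussBinom q u i + q ^ (i + 1) * gaussBinom q u (i + 1) :=
  rfl

theorem gaussBinom_eq_zero_of_lt {R : Type*} [CommRing R] (q : R) {u i : ℕ} (h : u < i) :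
    gaussBinom q u i = 0 := by
  induction u generalizing i with
  | zero =>
    obtain ⟨i, rfl⟩ := Nat.exists_eq_succ_of_ne_zero h.ne'
    rfl
  | succ u ih =>
    obtain ⟨i, rfl⟩ := Nat.exists_eq_succ_of_ne_zero (Nat.ne_zero_of_lt h)
    rw [Nat.succ_eq_add_one, gaussBinom_succ_succ, ih (by omega), ih (by omega), mul_zero,
      add_zero]

/-- The q-binomial theorem. -/
theorem q_binomial_theorem {R : Type*} [CommRing R] (q t : R) (u : ℕ) :
    ∏ i ∈ range u, (1 + q ^ i * t) =
      ∑ i ∈ range (u + 1), q ^ (Nat.choose i 2) * gaussBinom q u i * t ^ i := by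
  induction u generalizing t with
  | zero => simp [gaussBinom_zero_right]
  | succ u ih =>
    have hprod : ∏ i ∈ range u, (1 + q ^ (i + 1) * t) =
        ∑ i ∈ range (u + 1), q ^ (Nat.choose i 2) * gaussBinom q u i * (q * t) ^ i := by
      rw [← ih (q * t)]
      exact prod_congr rfl fun i _ => by ring
    have hshift : ∑ i ∈ range (u + 1), q ^ (Nat.choose i 2) * gaussBinom q u i * (q * t) ^ i =
        ∑ i ∈ range (u + 1),
          q ^ (Nat.choose (i + 1) 2) * gaussBinom q u (i + 1) * (q * t) ^ (i + 1) + 1 := by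
      have h := sum_range_succ
        (fun i => q ^ (Nat.choose i 2) * gaussBinom q u i * (q * t) ^ i) (u + 1)
      rw [sum_range_succ'] at h
      simpa [gaussBinom_eq_zero_of_lt q (Nat.lt_succ_self u), gaussBinom_zero_right] using h.symm
    rw [prod_range_succ', hprod, pow_zero, one_mul, mul_add, mul_one, sum_range_succ' _ (u + 1)]
    nth_rewrite 1 [hshift]
    rw [add_right_comm, sum_mul, ← sum_add_distrib, gaussBinom_zero_right]
    congr 1
    · refine sum_congr rfl fun i _ => ?_
      rw [gaussBinom_succ_succ, Nat.choose_succ_succ' i 1, Nat.choose_one_right]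
      ring
    · simp
end

section
/- Let m, d, e, k be as above and let a_0, a_1, ..., a_{k-1} ∈ F_{2^m} with (a_1,...,a_{k-1}) ≠ 0. Define the quadratic form Q(x) = Tr_{F_{2^m}/F_{2^e}}(a_0 x) + Σ_{j=1}^{k-1} Tr_{F_{2^m}/F_{2^e}}(a_j x^{2^{jd}+1}) on F_{2^m} viewed as an F_{2^e}-vector space, and let B(x,y) = Q(x+y) + Q(x) + Q(y) be the associated alternating bilinear form. Then the rank of B (as an F_{2^e}-bilinear form on F_{2^m}) is at least (m-e)/e - 2(k-2). -/
open Finset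

/-- The rank of an alternating bilinear form on a finite-dimensional space is even. -/
theorem LinearMap.IsAlt.even_finrank_add_finrank_ker {F : Type*} [Field F] {V : Type*}
    [AddCommGroup V] [Module F V] [FiniteDimensional F V] {B : V →ₗ[F] V →ₗ[F] F}
    (hB : B.IsAlt) : Even (Module.finrank F V + Module.finrank F (LinearMap.ker B)) := by
  induction hn : Module.finrank F V using Nat.strong_induction_on generalizing V with
  | _ n ih =>
  by_cases h0 : ∀ x y, B x y = 0
  · have hker : LinearMap.ker B = ⊤ := by
      rw [LinearMap.ker_eq_top]
      ext x y
      exact h0 x y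
    rw [hker, finrank_top, hn]
    exact ⟨n, rfl⟩
  push Not at h0
  obtain ⟨x, y, hxy⟩ := h0
  have hyx : B y x ≠ 0 := fun h => hxy (hB.eq_iff.1 h)
  set f : V →ₗ[F] F × F := (B x).prod (B y) with hf
  have hsurj : LinearMap.range f = ⊤ := by
    rw [LinearMap.range_eq_top]
    rintro ⟨s, t⟩
    refine ⟨(t / B y x) • x + (s / B x y) • y, ?_⟩
    simp [hf, hB.self_eq_zero, hxy, hyx]
  have hdim := LinearMap.finrank_range_add_finrank_ker f
  rw [hsurj, finrank_top, Module.finrank_prod, Module.finrank_self, hn] at hdim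
  set U := LinearMap.ker f
  have hU : ∀ u : V, u ∈ U ↔ B x u = 0 ∧ B y u = 0 := fun u => by simp [U, hf]
  have hker : (LinearMap.ker (B.domRestrict₁₂ U U)).map U.subtype = LinearMap.ker B := by
    ext v
    simp only [Submodule.mem_map, LinearMap.mem_ker, Submodule.subtype_apply]
    constructor
    · rintro ⟨u, hu, rfl⟩
      have hux := (hU u).1 u.2
      ext w
      obtain ⟨c, hc⟩ : ∃ c, c = (B y w / B y x) • x + (B x w / B x y) • y := ⟨_, rfl⟩
      have hw : w - c ∈ U := by
        rw [hU, hc]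
        simp [hB.self_eq_zero, hxy, hyx]
      have h1 : B u (w - c) = 0 := LinearMap.congr_fun hu ⟨w - c, hw⟩
      have h2 : B u c = 0 := by
        simp [hc, hB.eq_iff.1 hux.1, hB.eq_iff.1 hux.2]
      rw [map_sub, h2, sub_zero] at h1
      simpa using h1
    · intro hv
      have hvU : v ∈ U := by
        rw [hU, hB.eq_iff, hB.eq_iff (x := y), hv]
        simp
      refine ⟨⟨v, hvU⟩, ?_, rfl⟩
      ext w
      exact LinearMap.congr_fun hv w
  have hIH := ih (Module.finrank F U) (by omega) (V := U) (B := B.domRestrict₁₂ U U)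
    (fun u => hB.self_eq_zero u) rfl
  rw [← hker, Submodule.finrank_map_subtype_eq]
  rw [Nat.even_iff] at hIH ⊢
  omega

/-- Abel summation for a family whose coefficients add up to zero. -/
theorem sum_range_succ_mul_of_sum_eq_zero {R : Type*} [CommRing R] (n : ℕ) (c g : ℕ → R)
    (hc : ∑ i ∈ range (n + 1), c i = 0) :
    ∑ i ∈ range (n + 1), c i * g i =
      ∑ i ∈ range n, (-∑ j ∈ range (i + 1), c j) * (g (i + 1) - g i) := by
  have key : ∀ N, ∑ i ∈ range (N + 1), c i * g i = (∑ i ∈ range (N + 1), c i) * g N +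
      ∑ i ∈ range N, (-∑ j ∈ range (i + 1), c j) * (g (i + 1) - g i) := by
    intro N
    induction N with
    | zero => simp
    | succ N ih =>
      rw [sum_range_succ, ih, sum_range_succ (n := N + 1) (f := c), sum_range_succ (n := N)
        (f := fun i => (-∑ j ∈ range (i + 1), c j) * (g (i + 1) - g i))]
      ring
  rw [key, hc, zero_mul, zero_add]

/-- A nonzero skew polynomial of degree at most `n` in an automorphism `σ` has a kernel of
dimension at most `n` over the fixed field of `σ`. -/
theorem finrank_le_of_skew_polynomial_eq_zero {F K : Type*} [Field F] [Field K] [Algebra F K]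
    [FiniteDimensional F K] (σ : Gal(K/F)) (hσ : ∀ x, σ x = x → x ∈ Set.range (algebraMap F K))
    (n : ℕ) (c : ℕ → K) (hc : ∃ i ≤ n, c i ≠ 0) (W : Submodule F K)
    (hW : ∀ x ∈ W, ∑ i ∈ range (n + 1), c i * (σ ^ i) x = 0) : Module.finrank F W ≤ n := by
  induction n generalizing c W with
  | zero =>
    obtain ⟨i, hi, hci⟩ := hc
    obtain rfl : i = 0 := by omega
    have : W = ⊥ := by
      rw [Submodule.eq_bot_iff]
      intro x hx
      simpa only [zero_add, sum_range_one, pow_zero, AlgEquiv.one_apply, mul_eq_zero, hci, false_or]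
        using hW x hx
    simp [this]
  | succ n ih =>
    by_cases hbot : W = ⊥
    · rw [hbot, finrank_bot]
      exact Nat.zero_le _
    obtain ⟨u, huW, hu⟩ := Submodule.exists_mem_ne_zero_of_ne_bot hbot
    let μ : K ≃ₗ[F] K := LinearEquiv.ofBijective (LinearMap.mulLeft F u⁻¹)
      ⟨mul_right_injective₀ (inv_ne_zero hu), mul_left_surjective₀ (inv_ne_zero hu)⟩
    set W' := W.map (μ : K →ₗ[F] K) with hW'
    have hfin : Module.finrank F W' = Module.finrank F W := LinearEquiv.finrank_map_eq μ W
    set c' : ℕ → K := fun i => c i * (σ ^ i) u with hc'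
    have hmem : ∀ y ∈ W', u * y ∈ W := by
      rintro _ ⟨x, hx, rfl⟩
      have : u * (u⁻¹ * x) = x := mul_inv_cancel_left₀ hu x
      change u * (u⁻¹ * x) ∈ W
      rwa [this]
    have hone : (1 : K) ∈ W' := ⟨u, huW, inv_mul_cancel₀ hu⟩
    have hker : ∀ y ∈ W', ∑ i ∈ range (n + 1 + 1), c' i * (σ ^ i) y = 0 := by
      intro y hy
      rw [← hW _ (hmem y hy)]
      refine sum_congr rfl fun i _ => ?_
      rw [map_mul, hc', mul_assoc]
    have hsum : ∑ i ∈ range (n + 1 + 1), c' i = 0 := by simpa using hker 1 hone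
    set δ : K →ₗ[F] K := σ.toLinearMap - LinearMap.id with hδ
    have hδx : ∀ x, δ x = σ x - x := fun x => rfl
    have hle : Module.finrank F (W'.map δ) ≤ n := by
      refine ih (fun i => -∑ j ∈ range (i + 1), c' j) ?_ _ ?_
      · by_contra! h
        have hz : ∀ i ≤ n + 2, ∑ j ∈ range i, c' j = 0 := by
          intro i hi
          rcases i with _ | i
          · simp
          · rcases Nat.lt_or_ge n i with hi' | hi'
            · obtain rfl : i = n + 1 := by omega
              exact hsum
            · exact neg_eq_zero.1 (h i hi')
        obtain ⟨i, hi, hci⟩ := hc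
        have h1 := hz (i + 1) (by omega)
        rw [sum_range_succ, hz i (by omega), zero_add] at h1
        exact mul_ne_zero hci ((map_ne_zero (σ ^ i)).2 hu) h1
      · rintro _ ⟨y, hy, rfl⟩
        have h := hker y hy
        rw [sum_range_succ_mul_of_sum_eq_zero _ _ _ hsum] at h
        rw [← h]
        refine sum_congr rfl fun i _ => ?_
        rw [hδx, map_sub, pow_succ, AlgEquiv.mul_apply]
    have hrn := LinearMap.finrank_range_add_finrank_ker (δ.domRestrict W')
    rw [LinearMap.range_domRestrict] at hrn
    have hker1 : Module.finrank F (LinearMap.ker (δ.domRestrict W')) ≤ 1 := by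
      refine finrank_le_one ⟨⟨1, hone⟩, by simp [hδx]⟩ ?_
      rintro ⟨⟨w, hw⟩, hw0⟩
      obtain ⟨a, rfl⟩ := hσ w (sub_eq_zero.1 (by simpa [hδx] using hw0))
      exact ⟨a, by ext; simp [Algebra.smul_def]⟩
    omega

/-- The alternating form `∑ j, Tr (a j * (x * σ ^ j y + σ ^ j x * y))` has a radical of
dimension at most `2 * N` if some `a j` with `1 ≤ j ≤ N` is nonzero. -/
theorem finrank_le_two_mul_of_trace_form_eq_zero {F K : Type*} [Field F] [Field K] [Algebra F K]
    [FiniteDimensional F K] [Algebra.IsSeparable F K] (σ : Gal(K/F))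
    (hσ : ∀ x, σ x = x → x ∈ Set.range (algebraMap F K)) (N : ℕ) (a : ℕ → K)
    (ha : ∃ j ∈ Icc 1 N, a j ≠ 0) (W : Submodule F K)
    (hW : ∀ x ∈ W, ∀ y, ∑ j ∈ Icc 1 N,
      Algebra.trace F K (a j * (x * (σ ^ j) y + (σ ^ j) x * y)) = 0) :
    Module.finrank F W ≤ 2 * N := by
  refine finrank_le_of_skew_polynomial_eq_zero σ hσ (2 * N)
    (fun i => ∑ j ∈ Icc 1 N, ((if i = N + j then (σ ^ N) (a j) else 0) +
      (if i = N - j then (σ ^ (N - j)) (a j) else 0))) ?_ W ?_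
  · obtain ⟨j, hj, haj⟩ := ha
    have hj' := mem_Icc.1 hj
    refine ⟨N + j, by omega, ?_⟩
    rw [sum_eq_single_of_mem j hj]
    · rw [if_pos rfl, if_neg (by omega), add_zero]
      exact (map_ne_zero (σ ^ N)).2 haj
    · intro l hl hne
      rw [if_neg (by omega), if_neg (by omega), add_zero]
  · intro x hx
    have hexp : ∑ i ∈ range (2 * N + 1),
        (∑ j ∈ Icc 1 N, ((if i = N + j then (σ ^ N) (a j) else 0) +
          (if i = N - j then (σ ^ (N - j)) (a j) else 0))) * (σ ^ i) x =
        ∑ j ∈ Icc 1 N, ((σ ^ N) (a j) * (σ ^ (N + j)) x +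
          (σ ^ (N - j)) (a j) * (σ ^ (N - j)) x) := by
      simp only [sum_mul]
      rw [sum_comm]
      refine sum_congr rfl fun j hj => ?_
      have hj' := mem_Icc.1 hj
      simp only [add_mul, sum_add_distrib, ite_mul, zero_mul, sum_ite_eq', mem_range]
      rw [if_pos (by omega), if_pos (by omega)]
    rw [hexp]
    refine (traceForm_nondegenerate F K).1 _ fun z => ?_
    obtain ⟨y, rfl⟩ := (σ ^ N).surjective z
    rw [Algebra.traceForm_apply, sum_mul, map_sum, ← hW x hx y]
    refine sum_congr rfl fun j hj => ?_
    have hj' := mem_Icc.1 hj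
    have h1 : (σ ^ N) (a j) * (σ ^ (N + j)) x * (σ ^ N) y =
        (σ ^ N) (a j * ((σ ^ j) x * y)) := by
      rw [pow_add, AlgEquiv.mul_apply, map_mul, map_mul, mul_assoc]
    have h2 : (σ ^ (N - j)) (a j) * (σ ^ (N - j)) x * (σ ^ N) y =
        (σ ^ (N - j)) (a j * (x * (σ ^ j) y)) := by
      rw [map_mul, map_mul, ← AlgEquiv.mul_apply, ← pow_add, Nat.sub_add_cancel hj'.2, mul_assoc]
    rw [add_mul, h1, h2, map_add, Algebra.trace_eq_of_algEquiv, Algebra.trace_eq_of_algEquiv,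
      ← map_add, ← mul_add, add_comm]

/-- In an extension of finite fields, a power of Frobenius with exponent coprime to the degree
fixes only the base field. -/
theorem mem_range_algebraMap_of_frobenius_pow_eq {F K : Type*} [Field F] [Field K] [Algebra F K]
    [Fintype F] [Finite K] {t : ℕ} (ht : t.Coprime (Module.finrank F K)) (x : K)
    (hx : (FiniteField.frobeniusAlgEquivOfAlgebraic F K ^ t) x = x) :
    x ∈ Set.range (algebraMap F K) := by
  rw [← FiniteField.orderOf_frobeniusAlgEquivOfAlgebraic F K] at ht
  obtain ⟨s, hs⟩ := exists_pow_eq_self_of_coprime ht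
  have hfix : ∀ (g : Gal(K/F)), g x = x → ∀ n : ℕ, (g ^ n) x = x := by
    intro g hg n
    induction n with
    | zero => simp
    | succ n ih => rw [pow_succ, AlgEquiv.mul_apply, hg, ih]
  rw [IsGalois.mem_range_algebraMap_iff_fixed]
  intro g
  obtain ⟨i, rfl⟩ := (FiniteField.bijective_frobeniusAlgEquivOfAlgebraic_pow F K).2 g
  exact hfix _ (hs ▸ hfix _ hx s) _

/-- The rank of the alternating bilinear form associated to the quadratic form
`Q(x) = Tr(a_0 x) + Σ_{j=1}^{k-1} Tr(a_j x^{2^{jd}+1})` is at least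
`(m-e)/e - 2(k-2)`, provided `(a_1,…,a_{k-1}) ≠ 0`.  The rank is `m/e` minus
the `F_{2^e}`-dimension of the radical `{x : ∀ y, B x y = 0}`. -/
theorem rank_of_gold_bilinear_form_ge (m d e k : ℕ)
    (hm : 0 < m) (hd : 0 < d) (he : 0 < e)
    (he1 : e = Nat.gcd m d) (he2 : e = Nat.gcd m (2 * d))
    (hk1 : 2 ≤ k) (hk2 : k ≤ (m + e) / (2 * e))
    (F K : Type*) [Field F] [Field K] [Algebra F K] [Fintype F] [Fintype K]
    (hF : Fintype.card F = 2 ^ e) (hK : Fintype.card K = 2 ^ m)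
    (a : ℕ → K) (ha : ∃ j ∈ Finset.Icc 1 (k - 1), a j ≠ 0)
    (Q : K → F)
    (hQ : ∀ x, Q x = Algebra.trace F K (a 0 * x) +
      ∑ j ∈ Finset.Icc 1 (k - 1), Algebra.trace F K (a j * x ^ (2 ^ (j * d) + 1)))
    (B : K → K → F) (hB : ∀ x y, B x y = Q (x + y) + Q x + Q y)
    (W : Submodule F K) (hW : (W : Set K) = {x : K | ∀ y, B x y = 0}) :
    ((m / e : ℕ) : ℤ) - 1 - 2 * ((k : ℤ) - 2) ≤
      ((m / e : ℕ) : ℤ) - (Module.finrank F W : ℤ) := by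
  obtain ⟨t, ht⟩ : e ∣ d := he1 ▸ Nat.gcd_dvd_right m d
  set n := Module.finrank F K with hn
  have hmn : m = e * n := by
    have h := Module.card_eq_pow_finrank (K := F) (V := K)
    rw [hF, hK, ← pow_mul] at h
    exact Nat.pow_right_injective le_rfl h
  have hcop : t.Coprime n := by
    rw [hmn, ht, Nat.gcd_mul_left] at he1
    rw [Nat.coprime_comm]
    exact (Nat.eq_of_mul_eq_mul_left he (by rw [mul_one]; exact he1)).symm
  have hodd : Odd n := by
    rw [hmn, ht, mul_left_comm, Nat.gcd_mul_left] at he2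
    have h1 : n.gcd (2 * t) = 1 := (Nat.eq_of_mul_eq_mul_left he (by rw [mul_one]; exact he2)).symm
    exact Nat.Coprime.odd_of_right (Nat.Coprime.coprime_mul_right_right h1)
  set σ : Gal(K/F) := FiniteField.frobeniusAlgEquivOfAlgebraic F K ^ t with hσ
  have hσpow : ∀ j x, (σ ^ j) x = x ^ 2 ^ (j * d) := by
    intro j x
    rw [hσ, ← pow_mul, AlgEquiv.coe_pow, FiniteField.coe_frobeniusAlgEquivOfAlgebraic_iterate, hF,
      ← pow_mul, ht]
    ring
  have h2 : (2 : F) = 0 := by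
    have h := FiniteField.cast_card_eq_zero F
    rw [hF, Nat.cast_pow] at h
    exact_mod_cast pow_eq_zero_iff he.ne' |>.1 h
  have hdouble : ∀ z : F, z + z = 0 := fun z => by rw [← two_mul, h2, zero_mul]
  have hBσ : ∀ x y, B x y = ∑ j ∈ Icc 1 (k - 1),
      Algebra.trace F K (a j * (x * (σ ^ j) y + (σ ^ j) x * y)) := by
    intro x y
    simp only [mul_comm x]
    simp only [hB, hQ, pow_succ, ← hσpow, map_add, mul_add, add_mul, sum_add_distrib]
    linear_combination hdouble (Algebra.trace F K (a 0 * x)) +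
      hdouble (Algebra.trace F K (a 0 * y)) +
      hdouble (∑ j ∈ Icc 1 (k - 1), Algebra.trace F K (a j * ((σ ^ j) x * x))) +
      hdouble (∑ j ∈ Icc 1 (k - 1), Algebra.trace F K (a j * ((σ ^ j) y * y)))
  have hmemW : ∀ x, x ∈ W ↔ ∀ y, B x y = 0 := fun x => by
    rw [← SetLike.mem_coe, hW, Set.mem_ofPred_eq]
  have hle : Module.finrank F W ≤ 2 * (k - 1) :=
    finrank_le_two_mul_of_trace_form_eq_zero σ
      (fun x hx => mem_range_algebraMap_of_frobenius_pow_eq hcop x hx) (k - 1) a ha W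
      fun x hx y => by rw [← hBσ, (hmemW x).1 hx y]
  let β : K →ₗ[F] K →ₗ[F] F := LinearMap.mk₂ F B
    (fun x x' y => by
      simp only [hBσ, ← sum_add_distrib, ← map_add]
      exact sum_congr rfl fun j _ => by congr 1; rw [map_add]; ring)
    (fun r x y => by
      simp only [hBσ, smul_sum, ← map_smul]
      exact sum_congr rfl fun j _ => by congr 1; rw [map_smul]; simp only [Algebra.smul_def]; ring)
    (fun x y y' => by
      simp only [hBσ, ← sum_add_distrib, ← map_add]
      exact sum_congr rfl fun j _ => by congr 1; rw [map_add]; ring)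
    (fun r x y => by
      simp only [hBσ, smul_sum, ← map_smul]
      exact sum_congr rfl fun j _ => by congr 1; rw [map_smul]; simp only [Algebra.smul_def]; ring)
  have halt : β.IsAlt := fun x => by
    change B x x = 0
    rw [hBσ]
    refine sum_eq_zero fun j _ => ?_
    rw [mul_comm x, mul_add, map_add, hdouble]
  have hWker : W = LinearMap.ker β := by
    ext x
    rw [hmemW, LinearMap.mem_ker, LinearMap.ext_iff]
    rfl
  have heven := halt.even_finrank_add_finrank_ker
  rw [← hWker, ← hn] at heven
  rw [Nat.even_iff] at heven
  rw [Nat.odd_iff] at hodd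
  omega
end

section
/- Let m, e, d, k satisfy e = gcd(m,d) = gcd(m,2d), 2 ≤ k ≤ (m+e)/(2e). With Q_{a⃗}, the rank of the associated bilinear form B_{a⃗}, and the quantities α_{r,ε} and β_r as above, for each even r one has (α_{r,1} - α_{r,-1}) · 2^{m - er/2} = 2^m β_r and (α_{r,1} + α_{r,-1}) · 2^{2m - er} = 2^{2m} β_r, hence α_{r,ε} = (1/2)(2^{er} + ε 2^{er/2}) β_r for ε = ±1. -/
open Finset
open scoped Classical

/-! ### Sums of signs over finite groups of exponent two -/

section Signs

variable {G : Type*} [AddCommGroup G] [Fintype G]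

lemma neg_one_pow_val_add (x y : ZMod 2) :
    (-1 : ℤ) ^ (x + y).val = (-1) ^ x.val * (-1) ^ y.val := by
  revert x y; decide

lemma neg_one_pow_val_mul_self (x : ZMod 2) : (-1 : ℤ) ^ x.val * (-1) ^ x.val = 1 := by
  revert x; decide

lemma sum_neg_one_pow_addHom_of_ne_zero {f : G →+ ZMod 2} (hf : f ≠ 0) :
    ∑ x, (-1 : ℤ) ^ (f x).val = 0 := by
  obtain ⟨t, ht⟩ : ∃ t, f t ≠ 0 := by
    by_contra! h
    exact hf (AddMonoidHom.ext h)
  have ht1 : (-1 : ℤ) ^ (f t).val = -1 := by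
    revert ht
    generalize f t = z
    revert z; decide
  have h := Fintype.sum_equiv (Equiv.addRight t) (fun x => (-1 : ℤ) ^ (f (x + t)).val)
    (fun x => (-1 : ℤ) ^ (f x).val) (fun x => rfl)
  simp only [map_add, neg_one_pow_val_add, ht1, ← Finset.sum_mul] at h
  linarith

/-- Orthogonality of the additive characters of order at most two. -/
lemma sum_neg_one_pow_addHom (f : G →+ ZMod 2) :
    ∑ x, (-1 : ℤ) ^ (f x).val = if f = 0 then (Fintype.card G : ℤ) else 0 := by
  split_ifs with h
  · simp [h]
  · exact sum_neg_one_pow_addHom_of_ne_zero h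

/-- The sign sum of a quadratic map is zero, or its square is the order of the group times the
order of the radical. -/
lemma sq_sum_neg_one_pow_quadratic (q : G → ZMod 2) (b : G →+ G →+ ZMod 2)
    (hq : ∀ x y, q (x + y) = q x + q y + b x y)
    (h0 : ∑ x, (-1 : ℤ) ^ (q x).val ≠ 0) :
    (∑ x, (-1 : ℤ) ^ (q x).val) ^ 2 = Fintype.card G * Nat.card b.ker := by
  have hsymm : ∀ x y, b x y = b y x := fun x y => by
    have h1 := hq x y
    rw [add_comm x y, hq y x] at h1
    linear_combination -h1
  let f : b.ker →+ ZMod 2 := AddMonoidHom.mk' (fun z => q z) fun x y => by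
    have hx : b x = 0 := x.2
    simp [hq, hx]
  have hS : (∑ x, (-1 : ℤ) ^ (q x).val) ^ 2 =
      Fintype.card G * ∑ z : b.ker, (-1 : ℤ) ^ (f z).val := by
    calc (∑ x, (-1 : ℤ) ^ (q x).val) ^ 2
        = ∑ x, ∑ z, (-1 : ℤ) ^ (q x).val * (-1) ^ (q (x + z)).val := by
          rw [sq, Finset.sum_mul_sum]
          refine Finset.sum_congr rfl fun x _ => ?_
          exact (Fintype.sum_equiv (Equiv.addLeft x) _ _ fun z => rfl).symm
      _ = ∑ x, ∑ z, (-1 : ℤ) ^ (q z).val * (-1) ^ (b z x).val := by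
          refine Finset.sum_congr rfl fun x _ => Finset.sum_congr rfl fun z _ => ?_
          rw [hq, neg_one_pow_val_add, neg_one_pow_val_add, ← hsymm x z]
          linear_combination (-1 : ℤ) ^ (q z).val * (-1) ^ (b x z).val *
            neg_one_pow_val_mul_self (q x)
      _ = ∑ z, if b z = 0 then (Fintype.card G : ℤ) * (-1 : ℤ) ^ (q z).val else 0 := by
          rw [Finset.sum_comm]
          refine Finset.sum_congr rfl fun z _ => ?_
          rw [← Finset.mul_sum, sum_neg_one_pow_addHom]
          split_ifs <;> ring
      _ = Fintype.card G * ∑ z : b.ker, (-1 : ℤ) ^ (f z).val := by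
          rw [← Finset.sum_filter, ← Finset.mul_sum]
          congr 1
          exact Finset.sum_subtype _ (fun z => by simp [AddMonoidHom.mem_ker]) _
  rw [sum_neg_one_pow_addHom] at hS
  split_ifs at hS with hf
  · rw [hS, Nat.card_eq_fintype_card]
  · simp at hS
    exact absurd hS h0

end Signs

/-! ### The trace pairing -/

section TracePairing

variable (F : Type*) {K : Type*} [Field F] [Field K] [Algebra F K]
  [Algebra (ZMod 2) F]

/-- The additive map `y ↦ Tr_{F/𝔽₂} (Tr_{K/F} (x * y))`. -/
noncomputable def tracePairing : K →+ K →+ ZMod 2 :=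
  AddMonoidHom.mk' (fun x => AddMonoidHom.mk'
    (fun y => Algebra.trace (ZMod 2) F (Algebra.trace F K (x * y)))
    (fun y z => by simp [mul_add])) (fun x y => by ext z; simp [add_mul])

@[simp] lemma tracePairing_apply (x y : K) :
    tracePairing F x y = Algebra.trace (ZMod 2) F (Algebra.trace F K (x * y)) := rfl

lemma tracePairing_comm (x y : K) : tracePairing F x y = tracePairing F y x := by
  simp [mul_comm]

variable [Fintype F] [Fintype K]

lemma tracePairing_eq_zero_iff (x : K) : tracePairing F x = 0 ↔ x = 0 := by
  refine ⟨fun h => ?_, fun h => by simp [h]⟩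
  by_contra hx
  obtain ⟨u, hu⟩ := Algebra.trace_surjective (ZMod 2) F 1
  obtain ⟨v, rfl⟩ := Algebra.trace_surjective F K u
  have h1 : tracePairing F x (x⁻¹ * v) = 0 := by rw [h]; rfl
  rw [tracePairing_apply, mul_inv_cancel_left₀ hx, hu] at h1
  exact one_ne_zero h1

lemma trace_mul_eq_zero_iff (x : K) : (∀ y, Algebra.trace F K (x * y) = 0) ↔ x = 0 := by
  refine ⟨fun h => ?_, fun h => by simp [h]⟩
  rw [← tracePairing_eq_zero_iff F]
  ext y
  simp [h]

lemma sum_neg_one_pow_tracePairing (x : K) :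
    ∑ t, (-1 : ℤ) ^ (tracePairing F t x).val = if x = 0 then (Fintype.card K : ℤ) else 0 := by
  simp_rw [fun t => tracePairing_comm F t x]
  rw [sum_neg_one_pow_addHom]
  simp only [tracePairing_eq_zero_iff]

/-- Sum of the additive twists of a sign function. -/
lemma sum_twist (f : K → ZMod 2) (h0 : f 0 = 0) :
    ∑ t : K, ∑ x, (-1 : ℤ) ^ (f x + tracePairing F t x).val = Fintype.card K := by
  rw [Finset.sum_comm]
  simp_rw [neg_one_pow_val_add, ← Finset.mul_sum, sum_neg_one_pow_tracePairing]
  simp [h0]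

/-- Parseval identity for the additive twists of a sign function. -/
lemma sum_twist_sq (f : K → ZMod 2) :
    ∑ t : K, (∑ x, (-1 : ℤ) ^ (f x + tracePairing F t x).val) ^ 2 = (Fintype.card K : ℤ) ^ 2 := by
  have h2 : CharP K 2 := by
    have : CharP F 2 := charP_of_injective_algebraMap (algebraMap (ZMod 2) F).injective 2
    exact charP_of_injective_algebraMap (algebraMap F K).injective 2
  calc _ = ∑ t : K, ∑ x, ∑ y, (-1 : ℤ) ^ (f x).val * (-1) ^ (f y).val *
          (-1) ^ (tracePairing F t (x + y)).val := by
        refine Finset.sum_congr rfl fun t _ => ?_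
        rw [sq, Finset.sum_mul_sum]
        refine Finset.sum_congr rfl fun x _ => Finset.sum_congr rfl fun y _ => ?_
        rw [map_add, neg_one_pow_val_add, neg_one_pow_val_add, neg_one_pow_val_add]
        ring
    _ = ∑ x, ∑ y : K, if y = x then (Fintype.card K : ℤ) else 0 := by
        rw [Finset.sum_comm]
        refine Finset.sum_congr rfl fun x _ => ?_
        rw [Finset.sum_comm]
        refine Finset.sum_congr rfl fun y _ => ?_
        rw [← Finset.mul_sum, sum_neg_one_pow_tracePairing]
        simp only [CharTwo.add_eq_zero, eq_comm (a := x)]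
        split_ifs with h
        · rw [h, neg_one_pow_val_mul_self, one_mul]
        · simp
    _ = _ := by simp [sq]

end TracePairing

/-! ### The linear maps attached to the Gold quadratic forms -/

section GoldPolar

variable {F K : Type*} [Field F] [Field K] [Algebra F K] {k : ℕ}

/-- The `F`-linear map representing, through the trace pairing, the polar form of
`x ↦ ∑_{j ≠ 0} Tr (a j * (x * σ ^ j x))`. -/
noncomputable def goldPolar (σ : K ≃ₐ[F] K) (a : Fin k → K) : K →ₗ[F] K :=
  ∑ j ∈ Finset.univ.filter (fun j : Fin k => (j : ℕ) ≠ 0),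
    (LinearMap.mulLeft F (a j) ∘ₗ (σ ^ (j : ℕ)).toLinearMap +
      ((σ ^ (j : ℕ))⁻¹).toLinearMap ∘ₗ LinearMap.mulLeft F (a j))

lemma goldPolar_apply (σ : K ≃ₐ[F] K) (a : Fin k → K) (x : K) :
    goldPolar σ a x = ∑ j ∈ Finset.univ.filter (fun j : Fin k => (j : ℕ) ≠ 0),
      (a j * (σ ^ (j : ℕ)) x + (σ ^ (j : ℕ))⁻¹ (a j * x)) := by
  simp [goldPolar, LinearMap.sum_apply]

lemma trace_goldPolar_mul (σ : K ≃ₐ[F] K) (a : Fin k → K) (x y : K) :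
    Algebra.trace F K (goldPolar σ a x * y) =
      ∑ j ∈ Finset.univ.filter (fun j : Fin k => (j : ℕ) ≠ 0),
        Algebra.trace F K (a j * (x * (σ ^ (j : ℕ)) y + (σ ^ (j : ℕ)) x * y)) := by
  rw [goldPolar_apply, Finset.sum_mul, map_sum]
  refine Finset.sum_congr rfl fun j _ => ?_
  have h := Algebra.trace_eq_of_algEquiv (σ ^ (j : ℕ)) ((σ ^ (j : ℕ))⁻¹ (a j * x) * y)
  rw [map_mul, ← AlgEquiv.mul_apply, mul_inv_cancel, AlgEquiv.one_apply] at h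
  rw [add_mul, map_add, ← h, ← map_add]
  congr 1
  ring

lemma eq_zero_of_goldPolar_eq_zero {σ : K ≃ₐ[F] K} (hσ : 2 * k ≤ orderOf σ + 1)
    {a : Fin k → K} (h : goldPolar σ a = 0) (j : Fin k) (hj : (j : ℕ) ≠ 0) : a j = 0 := by
  let g : {j : Fin k // (j : ℕ) ≠ 0} × Bool → (K →* K) := fun p =>
    ((σ ^ (if p.2 then ((p.1 : Fin k) : ℤ) else -((p.1 : Fin k) : ℤ)) : K ≃ₐ[F] K) : K →* K)
  have hg : Function.Injective g := by
    rintro ⟨⟨i, hi⟩, b⟩ ⟨⟨j, hj⟩, c⟩ hij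
    have h1 : σ ^ (if b then (i : ℤ) else -(i : ℤ)) = σ ^ (if c then (j : ℤ) else -(j : ℤ)) :=
      AlgEquiv.ext fun x => DFunLike.congr_fun hij x
    rw [zpow_eq_zpow_iff_modEq, Int.modEq_iff_dvd] at h1
    have hi' := i.2
    have hj' := j.2
    have h2 := Int.eq_zero_of_abs_lt_dvd h1 (by
      rw [abs_lt]
      cases b <;> cases c <;> simp <;> omega)
    cases b <;> cases c <;> simp [Fin.ext_iff] at h2 ⊢ <;> omega
  have hli := (linearIndependent_monoidHom K K).comp g hg
  rw [Fintype.linearIndependent_iff] at hli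
  refine hli (fun p => if p.2 then a p.1 else (σ ^ ((p.1 : Fin k) : ℕ))⁻¹ (a p.1)) ?_
    (⟨j, hj⟩, true)
  ext x
  have hx : goldPolar σ a x = 0 := by rw [h]; rfl
  have hs (f : Fin k → K) : ∑ j ∈ Finset.univ.filter (fun j : Fin k => (j : ℕ) ≠ 0), f j =
      ∑ j : {j : Fin k // (j : ℕ) ≠ 0}, f j :=
    Finset.sum_subtype _ (by simp) f
  rw [goldPolar_apply, hs] at hx
  simpa [Fintype.sum_prod_type, g] using hx

end GoldPolar

/-! ### Gold forms and their exponential sums -/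

section GoldForm

variable {F K : Type*} [Field F] [Field K] [Algebra F K] {k : ℕ}

/-- The function `x ↦ Tr (a 0 * x) + ∑_{j ≠ 0} Tr (a j * (σ ^ j x * x))`. -/
noncomputable def goldForm (σ : K ≃ₐ[F] K) (a : Fin k → K) (x : K) : F :=
  ∑ j : Fin k, if (j : ℕ) = 0 then Algebra.trace F K (a j * x)
    else Algebra.trace F K (a j * ((σ ^ (j : ℕ)) x * x))

lemma goldForm_zero_right (σ : K ≃ₐ[F] K) (a : Fin k → K) : goldForm σ a 0 = 0 := by
  simp [goldForm]

lemma goldForm_zero_left (σ : K ≃ₐ[F] K) (x : K) : goldForm σ (0 : Fin k → K) x = 0 := by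
  simp [goldForm]

lemma goldForm_add_left (σ : K ≃ₐ[F] K) (a b : Fin k → K) (x : K) :
    goldForm σ (a + b) x = goldForm σ a x + goldForm σ b x := by
  rw [goldForm, goldForm, goldForm, ← Finset.sum_add_distrib]
  refine Finset.sum_congr rfl fun j _ => ?_
  split_ifs <;> simp [add_mul]

lemma goldForm_add_right (σ : K ≃ₐ[F] K) (a : Fin k → K) (x y : K) :
    goldForm σ a (x + y) =
      goldForm σ a x + goldForm σ a y + Algebra.trace F K (goldPolar σ a x * y) := by
  rw [trace_goldPolar_mul, Finset.sum_filter, goldForm, goldForm, goldForm,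
    ← Finset.sum_add_distrib, ← Finset.sum_add_distrib]
  refine Finset.sum_congr rfl fun j _ => ?_
  by_cases hj : (j : ℕ) = 0
  · simp [hj, mul_add]
  · simp only [hj, if_false, ne_eq, not_false_eq_true, if_true, ← map_add]
    congr 1
    rw [map_add]
    ring

lemma goldForm_of_forall_eq_zero (σ : K ≃ₐ[F] K) {a : Fin k → K}
    (ha : ∀ j : Fin k, (j : ℕ) ≠ 0 → a j = 0) (i : Fin k) (hi : (i : ℕ) = 0) (x : K) :
    goldForm σ a x = Algebra.trace F K (a i * x) := by
  rw [goldForm, Finset.sum_eq_single i]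
  · simp [hi]
  · intro j _ hj
    have hj0 : (j : ℕ) ≠ 0 := fun h => hj (Fin.ext (h.trans hi.symm))
    simp [hj0, ha j hj0]
  · simp

lemma goldForm_single (σ : K ≃ₐ[F] K) (i : Fin k) (hi : (i : ℕ) = 0) (t x : K) :
    goldForm σ (Pi.single i t) x = Algebra.trace F K (t * x) := by
  rw [goldForm_of_forall_eq_zero σ (fun j hj => ?_) i hi x]
  · simp
  · have hji : j ≠ i := fun h => hj (by rw [h, hi])
    simp [hji]

variable [Algebra (ZMod 2) F] [Fintype K]

/-- The exponential sum of a Gold form. -/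
noncomputable def goldSum (σ : K ≃ₐ[F] K) (a : Fin k → K) : ℤ :=
  ∑ x, (-1 : ℤ) ^ (Algebra.trace (ZMod 2) F (goldForm σ a x)).val

lemma goldSum_add_single (σ : K ≃ₐ[F] K) (a : Fin k → K) (i : Fin k) (hi : (i : ℕ) = 0) (t : K) :
    goldSum σ (a + Pi.single i t) = ∑ x, (-1 : ℤ) ^
      (Algebra.trace (ZMod 2) F (goldForm σ a x) + tracePairing F t x).val := by
  simp [goldSum, goldForm_add_left, goldForm_single σ i hi]

/-- Averaging over shifts of a coordinate. -/
lemma sum_mul_card_of_shift {i : Fin k} {A : Finset (Fin k → K)}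
    (hA : ∀ a t, a + (Pi.single i t : Fin k → K) ∈ A ↔ a ∈ A) (Φ : (Fin k → K) → ℤ) (c : ℤ)
    (hΦ : ∀ a, ∑ t, Φ (a + (Pi.single i t : Fin k → K)) = c) :
    (∑ a ∈ A, Φ a) * Fintype.card K = #A * c := by
  have h : ∀ t : K, ∑ a ∈ A, Φ (a + (Pi.single i t : Fin k → K)) = ∑ a ∈ A, Φ a := fun t =>
    Finset.sum_equiv (Equiv.addRight (Pi.single i t : Fin k → K)) (fun a => (hA a t).symm) fun a _ => rfl
  calc (∑ a ∈ A, Φ a) * Fintype.card K = ∑ t : K, ∑ a ∈ A, Φ (a + Pi.single i t) := by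
        simp [h, mul_comm]
    _ = #A * c := by
        rw [Finset.sum_comm]
        simp [hΦ]

variable [Fintype F]

lemma sq_goldSum (σ : K ≃ₐ[F] K) (a : Fin k → K) (h0 : goldSum σ a ≠ 0) :
    goldSum σ a ^ 2 =
      Fintype.card K * (Fintype.card F : ℤ) ^ Module.finrank F (goldPolar σ a).ker := by
  let b : K →+ K →+ ZMod 2 := (tracePairing F).comp (goldPolar σ a).toAddMonoidHom
  have hb : ∀ x, x ∈ b.ker ↔ x ∈ (goldPolar σ a).ker := fun x => by
    rw [AddMonoidHom.mem_ker, LinearMap.mem_ker]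
    exact tracePairing_eq_zero_iff F _
  rw [goldSum] at h0 ⊢
  rw [sq_sum_neg_one_pow_quadratic _ b (fun x y => ?_) h0]
  · have h1 : Nat.card b.ker = Nat.card (goldPolar σ a).ker :=
      Nat.card_congr (Equiv.subtypeEquivRight hb)
    rw [h1, Nat.card_eq_fintype_card, Module.card_eq_pow_finrank (K := F) (V := (goldPolar σ a).ker)]
    push_cast
    rfl
  · rw [goldForm_add_right, map_add, map_add]
    rfl

lemma eq_zero_of_trace_goldForm_eq_zero {σ : K ≃ₐ[F] K} (hσ : 2 * k ≤ orderOf σ + 1)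
    {a : Fin k → K} (h : ∀ x, Algebra.trace (ZMod 2) F (goldForm σ a x) = 0) : a = 0 := by
  have hpolar : goldPolar σ a = 0 := by
    ext x
    refine (tracePairing_eq_zero_iff F _).1 (AddMonoidHom.ext fun y => ?_)
    have h1 := h (x + y)
    rwa [goldForm_add_right, map_add, map_add, h, h, zero_add, zero_add] at h1
  have ha := eq_zero_of_goldPolar_eq_zero hσ hpolar
  funext i
  by_cases hi : (i : ℕ) = 0
  · refine (tracePairing_eq_zero_iff F _).1 (AddMonoidHom.ext fun y => ?_)
    have h1 := h y
    rwa [goldForm_of_forall_eq_zero σ ha i hi] at h1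
  · exact ha i hi

lemma goldSum_eq_zero_of_forall_eq_zero (σ : K ≃ₐ[F] K) {a : Fin k → K}
    (ha : ∀ j : Fin k, (j : ℕ) ≠ 0 → a j = 0) (i : Fin k) (hi : (i : ℕ) = 0) (h0 : a i ≠ 0) :
    goldSum σ a = 0 := by
  have h := sum_neg_one_pow_addHom_of_ne_zero (f := tracePairing F (a i))
    (by rwa [Ne, tracePairing_eq_zero_iff])
  simpa [goldSum, goldForm_of_forall_eq_zero σ ha i hi] using h

lemma sum_goldSum (σ : K ≃ₐ[F] K) {i : Fin k} (hi : (i : ℕ) = 0) {A : Finset (Fin k → K)}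
    (hA : ∀ a t, a + (Pi.single i t : Fin k → K) ∈ A ↔ a ∈ A) : ∑ a ∈ A, goldSum σ a = #A := by
  have h := sum_mul_card_of_shift hA (goldSum σ) (Fintype.card K) fun a => by
    simp_rw [goldSum_add_single σ a i hi]
    exact sum_twist F _ (by simp [goldForm_zero_right])
  exact mul_right_cancel₀ (by simp) h

lemma sum_sq_goldSum (σ : K ≃ₐ[F] K) {i : Fin k} (hi : (i : ℕ) = 0) {A : Finset (Fin k → K)}
    (hA : ∀ a t, a + (Pi.single i t : Fin k → K) ∈ A ↔ a ∈ A) :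
    ∑ a ∈ A, goldSum σ a ^ 2 = #A * Fintype.card K := by
  have h := sum_mul_card_of_shift hA (fun a => goldSum σ a ^ 2) (Fintype.card K ^ 2) fun a => by
    simp_rw [goldSum_add_single σ a i hi]
    exact sum_twist_sq F _
  refine mul_right_cancel₀ (b := (Fintype.card K : ℤ)) (by simp) ?_
  rw [h]
  ring

/-- The number of members of a shift-invariant family with a prescribed nonzero exponential sum,
when the nonzero sums have constant absolute value. -/
lemma card_goldSum_eq (σ : K ≃ₐ[F] K) {i : Fin k} (hi : (i : ℕ) = 0) {A : Finset (Fin k → K)}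
    (hA : ∀ a t, a + (Pi.single i t : Fin k → K) ∈ A ↔ a ∈ A) {M ε : ℤ} (hε : ε = 1 ∨ ε = -1)
    (hS : ∀ a ∈ A, goldSum σ a ≠ 0 → goldSum σ a ^ 2 = M ^ 2) :
    2 * M ^ 2 * #(A.filter fun a => goldSum σ a = ε * M) = #A * (Fintype.card K + ε * M) := by
  have hε2 : ε ^ 2 = 1 := by rcases hε with rfl | rfl <;> norm_num
  have h : ∀ a ∈ A, goldSum σ a ^ 2 + ε * M * goldSum σ a =
      if goldSum σ a = ε * M then 2 * M ^ 2 else 0 := fun a ha => by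
    split_ifs with h1
    · rw [h1]
      linear_combination 2 * M ^ 2 * hε2
    · by_cases h0 : goldSum σ a = 0
      · simp [h0]
      · have h2 : (goldSum σ a - ε * M) * (goldSum σ a + ε * M) = 0 := by
          linear_combination hS a ha h0 - M ^ 2 * hε2
        have h3 := (mul_eq_zero.1 h2).resolve_left (sub_ne_zero.2 h1)
        linear_combination goldSum σ a * h3
  have h1 := Finset.sum_congr rfl h
  rw [Finset.sum_add_distrib, ← Finset.mul_sum, sum_goldSum σ hi hA, sum_sq_goldSum σ hi hA,
    ← Finset.sum_filter, Finset.sum_const, nsmul_eq_mul] at h1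
  linear_combination -h1

end GoldForm

section PrimitiveElement

variable {K : Type*} [Field K] {π : K} {n : ℕ}

lemma injective_pow_inv_primitive (hπ : orderOf π = n) :
    Function.Injective fun i : Fin n => π⁻¹ ^ (i : ℕ) := fun i j hij => by
  simp only [inv_pow, inv_inj] at hij
  exact Fin.ext (pow_injOn_Iio_orderOf (by simp [hπ]) (by simp [hπ]) hij)

variable [Fintype K]

/-- The powers of the inverse of a primitive element are the nonzero elements. -/
lemma image_pow_inv_primitive (hn : Fintype.card K = n + 1) (hπ : orderOf π = n) :
    Finset.univ.image (fun i : Fin n => π⁻¹ ^ (i : ℕ)) = Finset.univ.erase 0 := by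
  have hπ0 : π ≠ 0 := by
    rintro rfl
    rw [orderOf_zero] at hπ
    rw [← hπ] at hn
    exact absurd hn (Fintype.one_lt_card (α := K)).ne'
  refine Finset.eq_of_subset_of_card_le (fun x hx => ?_) ?_
  · obtain ⟨i, -, rfl⟩ := Finset.mem_image.1 hx
    simp [hπ0]
  · rw [Finset.card_image_of_injective _ (injective_pow_inv_primitive hπ)]
    simp [hn]

lemma sum_pow_inv_primitive (hn : Fintype.card K = n + 1) (hπ : orderOf π = n) (f : K → ℤ) :
    ∑ i : Fin n, f (π⁻¹ ^ (i : ℕ)) = ∑ x, f x - f 0 := by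
  rw [eq_sub_iff_add_eq, ← Finset.sum_erase_add _ _ (Finset.mem_univ (0 : K)),
    ← image_pow_inv_primitive hn hπ,
    Finset.sum_image fun i _ j _ hij => injective_pow_inv_primitive hπ hij]

end PrimitiveElement

open FiniteField in
lemma frobenius_pow_pow_apply {F K : Type*} [Field F] [Field K] [Algebra F K] [Fintype F]
    [Fintype K] {e : ℕ} (hF : Fintype.card F = 2 ^ e) (n j : ℕ) (x : K) :
    ((frobeniusAlgEquivOfAlgebraic F K ^ n) ^ j) x = x ^ 2 ^ (j * (e * n)) := by
  rw [← pow_mul, AlgEquiv.coe_pow, coe_frobeniusAlgEquivOfAlgebraic_iterate, hF, ← pow_mul]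
  ring_nf

/-- Relation between the DC-component frequencies `α_{r,ε}` of the Gold type
code and the rank frequencies `β_r = 2^{-m}·#{a⃗ : rk(B_{a⃗}) = r, (a_1,…,a_{k-1}) ≠ 0}`:
`α_{r,ε} = (1/2)(2^{er} + ε·2^{er/2})·β_r`. -/
theorem alpha_beta_relation (m d e k : ℕ)
    (hm : 0 < m) (hd : 0 < d) (he : 0 < e)
    (he1 : e = Nat.gcd m d) (he2 : e = Nat.gcd m (2 * d))
    (hk1 : 2 ≤ k) (hk2 : k ≤ (m + e) / (2 * e))
    (F K : Type*) [Field F] [Field K] [Algebra F K] [Fintype F] [Fintype K]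
    [Algebra (ZMod 2) F]
    (hF : Fintype.card F = 2 ^ e) (hK : Fintype.card K = 2 ^ m)
    (π : K) (hπ : orderOf π = 2 ^ m - 1)
    -- the quadratic forms
    (Q : (Fin k → K) → K → F)
    (hQ : ∀ a x, Q a x = ∑ j : Fin k,
      (if (j : ℕ) = 0 then Algebra.trace F K (a j * x)
       else Algebra.trace F K (a j * x ^ (2 ^ ((j : ℕ) * d) + 1))))
    -- the codewords
    (cw : (Fin k → K) → Fin (2 ^ m - 1) → ZMod 2)
    (hcw : ∀ a i, cw a i = Algebra.trace (ZMod 2) F (Q a (π⁻¹ ^ (i : ℕ))))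
    -- DC component
    (DC : (Fin (2 ^ m - 1) → ZMod 2) → ℤ)
    (hDC : ∀ c, DC c = ∑ i : Fin (2 ^ m - 1), (-1 : ℤ) ^ (c i).val)
    -- rank of the associated alternating bilinear form
    (rk : (Fin k → K) → ℕ)
    (hrk : ∀ (a : Fin k → K) (W : Submodule F K),
      (W : Set K) = {x : K | ∀ y : K,
        ∑ j ∈ Finset.univ.filter (fun j : Fin k => (j : ℕ) ≠ 0),
          Algebra.trace F K (a j * (x * y ^ (2 ^ ((j : ℕ) * d)) +
            x ^ (2 ^ ((j : ℕ) * d)) * y)) = 0} →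
      rk a = m / e - Module.finrank F W)
    (r : ℕ) (hr : Even r) (ε : ℤ) (hε : ε = 1 ∨ ε = -1) :
    ((Finset.univ.image cw).filter
        (fun c => c ≠ 0 ∧ DC c = -1 + ε * 2 ^ (m - e * (r / 2)))).card =
      (1 / 2 : ℚ) * ((2 : ℚ) ^ (e * r) + (ε : ℚ) * 2 ^ (e * (r / 2))) *
        (((Finset.univ.filter (fun a : Fin k → K =>
            rk a = r ∧ ∃ j : Fin k, (j : ℕ) ≠ 0 ∧ a j ≠ 0)).card : ℚ) / 2 ^ m) := by
  obtain ⟨E, hE⟩ : e ∣ m := he1 ▸ Nat.gcd_dvd_left m d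
  obtain ⟨n, hn⟩ : e ∣ d := he1 ▸ Nat.gcd_dvd_right m d
  have hcop : Nat.gcd E n = 1 := by
    rw [hE, hn, Nat.gcd_mul_left] at he1
    exact Nat.eq_of_mul_eq_mul_left he (by omega)
  have hdim : Module.finrank F K = E := by
    have h := Module.card_eq_pow_finrank (K := F) (V := K)
    rw [hK, hF, ← pow_mul] at h
    have h1 := Nat.pow_right_injective le_rfl h
    exact Nat.eq_of_mul_eq_mul_left he (by omega)
  have hmE : m / e = E := by rw [hE, Nat.mul_div_cancel_left _ he]
  let σ : K ≃ₐ[F] K := FiniteField.frobeniusAlgEquivOfAlgebraic F K ^ n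
  have hσx : ∀ (j : ℕ) (x : K), (σ ^ j) x = x ^ 2 ^ (j * d) := fun j x => by
    rw [hn]
    exact frobenius_pow_pow_apply hF n j x
  have hσ : 2 * k ≤ orderOf σ + 1 := by
    have h : orderOf σ = E := by
      rw [orderOf_pow, FiniteField.orderOf_frobeniusAlgEquivOfAlgebraic, hdim, hcop, Nat.div_one]
    rw [h]
    have h1 := (Nat.le_div_iff_mul_le (by omega)).1 hk2
    have h2 : e * (2 * k) ≤ e * (E + 1) := by linarith
    exact Nat.le_of_mul_le_mul_left h2 he
  let i0 : Fin k := ⟨0, by omega⟩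
  have hi0 : (i0 : ℕ) = 0 := rfl
  have hQσ : ∀ a x, Q a x = goldForm σ a x := fun a x => by
    rw [hQ, goldForm]
    simp only [hσx, pow_succ]
  have hcard : Fintype.card K = (2 ^ m - 1) + 1 := by
    rw [hK, Nat.sub_add_cancel Nat.one_le_two_pow]
  have hDCσ : ∀ a, DC (cw a) = goldSum σ a - 1 := fun a => by
    rw [hDC]
    simp only [hcw, hQσ]
    rw [sum_pow_inv_primitive hcard hπ
      (fun x => (-1 : ℤ) ^ (Algebra.trace (ZMod 2) F (goldForm σ a x)).val)]
    simp [goldSum, goldForm_zero_right]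
  have hcw0 : ∀ a, cw a = 0 → a = 0 := fun a ha => by
    refine eq_zero_of_trace_goldForm_eq_zero hσ fun x => ?_
    by_cases hx : x = 0
    · simp [hx, goldForm_zero_right]
    · have hx' : x ∈ Finset.univ.image fun i : Fin (2 ^ m - 1) => π⁻¹ ^ (i : ℕ) := by
        rw [image_pow_inv_primitive hcard hπ]
        simp [hx]
      obtain ⟨i, -, rfl⟩ := Finset.mem_image.1 hx'
      rw [← hQσ, ← hcw, ha]
      rfl
  have hcwinj : Function.Injective cw := fun a b hab => by
    have h : cw (b + (a - b)) = cw b + cw (a - b) := by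
      funext i
      simp only [hcw, hQσ, goldForm_add_left, map_add, Pi.add_apply]
    rw [add_sub_cancel, hab, left_eq_add] at h
    exact sub_eq_zero.1 (hcw0 _ h)
  have hrkσ : ∀ a, rk a = E - Module.finrank F (goldPolar σ a).ker := fun a => by
    rw [← hmE]
    refine hrk a _ (Set.ext fun x => ?_)
    rw [SetLike.mem_coe, LinearMap.mem_ker, ← trace_mul_eq_zero_iff F]
    simp only [trace_goldPolar_mul, hσx, Set.mem_ofPred_eq]
  set M : ℤ := 2 ^ (m - e * (r / 2)) with hM
  have hM0 : M ≠ 0 := by positivity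
  have hsq : ∀ a, goldSum σ a ≠ 0 → goldSum σ a ^ 2 = 2 ^ (2 * m - e * rk a) := fun a ha => by
    have hle : Module.finrank F (goldPolar σ a).ker ≤ E := hdim ▸ Submodule.finrank_le _
    rw [sq_goldSum σ a ha, hK, hF, hrkσ]
    push_cast
    rw [← pow_mul, ← pow_add]
    congr 1
    rw [Nat.mul_sub, ← hE]
    have := Nat.mul_le_mul_left e hle
    omega
  have hrkle : ∀ a, e * rk a ≤ m := fun a => by
    rw [hE, hrkσ]
    exact Nat.mul_le_mul_left _ (Nat.sub_le _ _)
  obtain ⟨s, hs⟩ : ∃ s, r = 2 * s := ⟨r / 2, by have := Nat.even_iff.1 hr; omega⟩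
  have hrs : r / 2 = s := by omega
  rw [hrs] at hM ⊢
  have hε2 : ε ^ 2 = 1 := by rcases hε with rfl | rfl <;> norm_num
  set A : Finset (Fin k → K) :=
    Finset.univ.filter (fun a => rk a = r ∧ ∃ j : Fin k, (j : ℕ) ≠ 0 ∧ a j ≠ 0) with hA
  have hAshift : ∀ a t, a + (Pi.single i0 t : Fin k → K) ∈ A ↔ a ∈ A := fun a t => by
    have hne : ∀ j : Fin k, (j : ℕ) ≠ 0 → (a + (Pi.single i0 t : Fin k → K)) j = a j := fun j hj => by
      have : j ≠ i0 := fun h => hj (by rw [h])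
      simp [this]
    have hpol : goldPolar σ (a + (Pi.single i0 t : Fin k → K)) = goldPolar σ a := by
      ext x
      rw [goldPolar_apply, goldPolar_apply]
      refine Finset.sum_congr rfl fun j hj => ?_
      rw [hne j (Finset.mem_filter.1 hj).2]
    have hrka : rk (a + (Pi.single i0 t : Fin k → K)) = rk a := by rw [hrkσ, hrkσ, hpol]
    simp only [hA, Finset.mem_filter, Finset.mem_univ, true_and, hrka]
    refine and_congr_right fun _ => exists_congr fun j => and_congr_right fun hj => ?_
    rw [hne j hj]
  have hMsq : ∀ a, rk a = r → M ^ 2 = 2 ^ (2 * m - e * rk a) := fun a ha => by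
    rw [hM, ← pow_mul, ha, hs]
    congr 1
    rw [Nat.sub_mul]
    congr 1 <;> ring
  have hcount := card_goldSum_eq σ hi0 hAshift (M := M) hε fun a ha h0 => by
    rw [hsq a h0, hMsq a (Finset.mem_filter.1 ha).2.1]
  have hmem : ∀ a, (cw a ≠ 0 ∧ DC (cw a) = -1 + ε * M) ↔ (a ∈ A ∧ goldSum σ a = ε * M) :=
    fun a => by
    rw [hDCσ, hA, Finset.mem_filter]
    constructor
    · rintro ⟨h1, h2⟩
      have hS : goldSum σ a = ε * M := by linarith
      have hS0 : goldSum σ a ≠ 0 := by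
        rw [hS]
        rcases hε with rfl | rfl <;> simpa using hM0
      refine ⟨⟨Finset.mem_univ _, ?_, ?_⟩, hS⟩
      · have h3 := hsq a hS0
        rw [hS, mul_pow, hε2, one_mul, hM, ← pow_mul] at h3
        have h4 : (m - e * s) * 2 = 2 * m - e * rk a :=
          Int.pow_right_injective (by norm_num) h3
        have h5 := hrkle a
        have h6 : e * rk a = e * r := by
          have : e * r = 2 * (e * s) := by rw [hs]; ring
          omega
        exact Nat.eq_of_mul_eq_mul_left he h6
      · by_contra! h
        refine hS0 (goldSum_eq_zero_of_forall_eq_zero σ h i0 hi0 fun h0 => h1 ?_)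
        funext i
        have ha : a = 0 := funext fun j => by
          by_cases hj : (j : ℕ) = 0
          · rw [show j = i0 from Fin.ext hj, h0]
            rfl
          · exact h j hj
        simp [hcw, hQσ, ha, goldForm_zero_left]
    · rintro ⟨⟨-, -, j, -, hj⟩, h2⟩
      refine ⟨fun h => hj ?_, by linarith⟩
      rw [hcw0 a h]
      rfl
  have himg : #((Finset.univ.image cw).filter fun c => c ≠ 0 ∧ DC c = -1 + ε * M) =
      #(A.filter fun a => goldSum σ a = ε * M) := by
    rw [Finset.filter_image, Finset.card_image_of_injective _ hcwinj]
    congr 1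
    ext a
    simp only [Finset.mem_filter, Finset.mem_univ, true_and]
    exact hmem a
  rw [himg]
  rcases A.eq_empty_or_nonempty with hAe | ⟨a, ha⟩
  · simp [hAe]
  have hes : e * s ≤ m := by
    have h1 := hrkle a
    rw [(Finset.mem_filter.1 ha).2.1, hs] at h1
    exact le_trans (Nat.mul_le_mul_left e (by omega)) h1
  have hMu : (M : ℚ) * 2 ^ (e * s) = 2 ^ m := by
    rw [hM]
    push_cast
    rw [← pow_add, Nat.sub_add_cancel hes]
  have hsqu : (2 : ℚ) ^ (e * r) = (2 ^ (e * s)) ^ 2 := by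
    rw [← pow_mul, hs]
    congr 1
    ring
  have hcount' := congrArg (Int.cast : ℤ → ℚ) hcount
  push_cast [hK] at hcount'
  have hMQ : (M : ℚ) ≠ 0 := by exact_mod_cast hM0
  rw [hsqu, ← hMu]
  rw [← hMu] at hcount'
  have hu : (2 : ℚ) ^ (e * s) ≠ 0 := by positivity
  generalize (2 : ℚ) ^ (e * s) = u at *
  field_simp
  refine mul_left_cancel₀ hMQ ?_
  linear_combination hcount'
end

section
/- Let M be an odd positive integer, q a prime power, and Y an F_q-linear subspace of the space of alternating bilinear forms on an M-dimensional F_q-vector space. Let d(Y) = min{rk(y) : 0 ≠ y ∈ Y}. Then |Y| ≤ q^{M(M - d(Y) + 1)/2}. -/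
open Finset

open Module

section AlternatingForms

variable {F V : Type*} [Field F] [AddCommGroup V] [Module F V]

theorem LinearMap.IsAlt.exists_finrank_eq_finrank_ker_add_two_mul [FiniteDimensional F V]
    {B : V →ₗ[F] V →ₗ[F] F} (hB : B.IsAlt) :
    ∃ k, finrank F V = finrank F (LinearMap.ker B) + 2 * k := by
  induction hn : finrank F V using Nat.strong_induction_on generalizing V with
  | _ n ih =>
  subst hn
  by_cases h0 : B = 0
  · exact ⟨0, by rw [h0, LinearMap.ker_zero, finrank_top, mul_zero, add_zero]⟩
  obtain ⟨x, y, hxy⟩ : ∃ x y, B x y = 1 := by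
    by_contra! h
    refine h0 (LinearMap.ext₂ fun x y => ?_)
    by_contra hne
    exact h x ((B x y)⁻¹ • y) (by simpa using inv_mul_cancel₀ hne)
  have hyx : B y x = -1 := by rw [← hB.neg, hxy]
  let π : V →ₗ[F] F × F := (B x).prod (B y)
  have hπ : Function.Surjective π := fun ⟨a, b⟩ =>
    ⟨a • y - b • x, by simp [π, hxy, hyx, hB.self_eq_zero]⟩
  have hdim : 2 + finrank F (LinearMap.ker π) = finrank F V := by
    have := π.finrank_range_add_finrank_ker
    rwa [LinearMap.range_eq_top.2 hπ, finrank_top, finrank_prod, finrank_self] at this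
  let B' : LinearMap.ker π →ₗ[F] LinearMap.ker π →ₗ[F] F :=
    B.compl₁₂ (LinearMap.ker π).subtype (LinearMap.ker π).subtype
  have hker : (LinearMap.ker B').map (LinearMap.ker π).subtype = LinearMap.ker B := by
    ext w
    constructor
    · rintro ⟨w, hw, rfl⟩
      refine LinearMap.ext fun v => ?_
      have hw' : B x w = 0 ∧ B y w = 0 := by simpa [π] using w.2
      have hv : v - B x v • y + B y v • x ∈ LinearMap.ker π := by
        simp [π, hxy, hyx, hB.self_eq_zero]
      have := LinearMap.congr_fun (LinearMap.mem_ker.1 hw) ⟨_, hv⟩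
      simpa [B', hB.eq_iff.1 hw'.1, hB.eq_iff.1 hw'.2] using this
    · intro hw
      have hw0 : ∀ v, B w v = 0 := fun v => LinearMap.congr_fun (LinearMap.mem_ker.1 hw) v
      have hwπ : w ∈ LinearMap.ker π := by
        simp [π, hB.eq_iff.1 (hw0 x), hB.eq_iff.1 (hw0 y)]
      exact ⟨⟨w, hwπ⟩, LinearMap.ext fun v => hw0 v, rfl⟩
  obtain ⟨k, hk⟩ := ih _ (by omega) (B := B') (fun v => hB v) rfl
  rw [← hker, Submodule.finrank_map_subtype_eq]
  exact ⟨k + 1, by omega⟩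

variable (F V) in
/-- The space of alternating bilinear forms on `V`. -/
def altForms : Submodule F (V →ₗ[F] V →ₗ[F] F) where
  carrier := {B | B.IsAlt}
  add_mem' ha hb x := by simp [ha x, hb x]
  zero_mem' x := rfl
  smul_mem' c B hB x := by simp [hB x]

/-- The general instance for submodules does not unify here at instance transparency. -/
noncomputable instance : AddCommGroup (altForms F V) := Module.addCommMonoidToAddCommGroup F

/-- The alternating form `u ∧ v : (x, y) ↦ u x * v y - v x * u y`. -/
def wedge : Dual F V →ₗ[F] Dual F V →ₗ[F] altForms F V :=
  LinearMap.mk₂ F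
    (fun u v => ⟨u.smulRight v - v.smulRight u, fun x => by simp [mul_comm]⟩)
    (fun u₁ u₂ v => by ext; simp; ring)
    (fun c u v => by ext; simp; ring)
    (fun u v₁ v₂ => by ext; simp; ring)
    (fun c u v => by ext; simp; ring)

@[simp]
theorem wedge_apply (u v : Dual F V) (x y : V) :
    (wedge u v : V →ₗ[F] V →ₗ[F] F) x y = u x * v y - v x * u y := rfl

/-- The radical of the alternating form `(u, v) ↦ φ (u ∧ v)` on the dual space. -/
def wedgeRad (φ : Dual F (altForms F V)) : Submodule F (Dual F V) :=
  LinearMap.ker (wedge.compr₂ φ)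

theorem mem_wedgeRad {φ : Dual F (altForms F V)} {u : Dual F V} :
    u ∈ wedgeRad φ ↔ ∀ v, φ (wedge u v) = 0 := by
  rw [wedgeRad, LinearMap.mem_ker, LinearMap.ext_iff]
  rfl

theorem exists_finrank_eq_finrank_wedgeRad_add_two_mul [FiniteDimensional F V]
    (φ : Dual F (altForms F V)) : ∃ k, finrank F V = finrank F (wedgeRad φ) + 2 * k := by
  have h : (wedge.compr₂ φ).IsAlt := fun u => by
    have : wedge u u = 0 := by ext; simp
    simp [this]
  rw [← Subspace.dual_finrank_eq]
  exact h.exists_finrank_eq_finrank_ker_add_two_mul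

section Basis

variable {ι : Type*} [LinearOrder ι] (e : Basis ι F V)

theorem wedge_coord_apply_basis {i j a b : ι} (hij : i < j) (hab : a < b) :
    (wedge (e.coord i) (e.coord j) : V →ₗ[F] V →ₗ[F] F) (e a) (e b) =
      if i = a ∧ j = b then 1 else 0 := by
  have h : ¬ (j = a ∧ i = b) := fun h => by
    rw [h.1, h.2] at hij
    exact lt_asymm hij hab
  simp only [wedge_apply, Basis.coord_apply, Basis.repr_self, Finsupp.single_apply]
  split_ifs <;> first | (exfalso; tauto) | simp

theorem LinearMap.IsAlt.ext_basis_of_lt {B C : V →ₗ[F] V →ₗ[F] F} (hB : B.IsAlt) (hC : C.IsAlt)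
    (h : ∀ i j, i < j → B (e i) (e j) = C (e i) (e j)) : B = C := by
  refine LinearMap.ext_basis e e fun i j => ?_
  rcases lt_trichotomy i j with hij | rfl | hij
  · exact h i j hij
  · rw [hB, hC]
  · rw [← hB.neg, ← hC.neg, h j i hij]

theorem altForms_eq_sum_wedge [Fintype ι] (B : altForms F V) :
    B = ∑ p : {p : ι × ι // p.1 < p.2},
      (B : V →ₗ[F] V →ₗ[F] F) (e p.1.1) (e p.1.2) • wedge (e.coord p.1.1) (e.coord p.1.2) := by
  refine Subtype.ext (B.2.ext_basis_of_lt e (Subtype.prop _) fun i j hij => ?_)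
  rw [Submodule.coe_sum, LinearMap.sum_apply, LinearMap.sum_apply,
    Finset.sum_eq_single ⟨(i, j), hij⟩]
  · rw [Submodule.coe_smul, LinearMap.smul_apply, LinearMap.smul_apply,
      wedge_coord_apply_basis e hij hij]
    simp
  · intro p _ hp
    rw [Submodule.coe_smul, LinearMap.smul_apply, LinearMap.smul_apply,
      wedge_coord_apply_basis e p.2 hij, if_neg, smul_zero]
    rintro ⟨h₁, h₂⟩
    exact hp (Subtype.ext (Prod.ext h₁ h₂))
  · simp

end Basis

theorem LinearIndependent.exists_basis_coord_castAdd_eq [FiniteDimensional F V] {r : ℕ}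
    {u : Fin r → Dual F V} (hu : LinearIndependent F u) :
    ∃ n, r + n = finrank F V ∧ ∃ e : Basis (Fin (r + n)) F V,
      ∀ i, e.coord (Fin.castAdd n i) = u i := by
  classical
  have : Finite (Fin r ⊕ (Basis.sumExtendIndex hu)) :=
    Module.Finite.finite_basis (Basis.sumExtend hu)
  have : Finite (Basis.sumExtendIndex hu) := Finite.sum_right (Fin r)
  have := Fintype.ofFinite (Basis.sumExtendIndex hu)
  let n := Fintype.card (Basis.sumExtendIndex hu)
  let b : Basis (Fin (r + n)) F (Dual F V) := (Basis.sumExtend hu).reindex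
    ((Equiv.sumCongr (Equiv.refl _) (Fintype.equivFin _)).trans finSumFinEquiv)
  have hb : ∀ i, b (Fin.castAdd n i) = u i := fun i => by
    have h : (finSumFinEquiv.symm (Fin.castAdd n i) : Fin r ⊕ Fin n) = Sum.inl i :=
      finSumFinEquiv_symm_apply_castAdd i
    rw [Basis.reindex_apply, Equiv.symm_trans_apply, h]
    simp [Basis.sumExtend]
    rfl
  refine ⟨n, ?_, b.dualBasis.map (evalEquiv F V).symm, fun i => ?_⟩
  · rw [← Subspace.dual_finrank_eq, finrank_eq_card_basis b, Fintype.card_fin]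
  · rw [← hb]
    refine (b.dualBasis.map (evalEquiv F V).symm).ext fun j => ?_
    rw [Basis.coord_apply, Basis.repr_self, Basis.map_apply, apply_evalEquiv_symm_apply,
      Basis.dualBasis_apply_self, Finsupp.single_apply]
    simp only [eq_comm]

theorem card_fin_pairs_lt (n : ℕ) :
    Fintype.card {p : Fin n × Fin n // p.1 < p.2} = n.choose 2 := by
  have h (j : Fin n) : #{i : Fin n | i < j} = (j : ℕ) := by
    rw [Finset.filter_gt_eq_Iio, Fin.card_Iio]
  rw [Fintype.card_subtype, Finset.card_filter, Fintype.sum_prod_type_right]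
  simp_rw [← Finset.card_filter, h]
  rw [Fin.sum_univ_eq_sum_range (fun j => j), Finset.sum_range_id, Nat.choose_two_right]

/-- The dimension of the space of functionals vanishing on `Y` and on the forms `u i ∧ v`, for a
frame `u`, when `Y` contains only forms of large rank. -/
theorem finrank_dualAnnihilator_inf_add_finrank [FiniteDimensional F V] {r : ℕ}
    {u : Fin r → Dual F V} (hu : LinearIndependent F u) (Y : Submodule F (altForms F V))
    (hY : ∀ B ∈ Y, B ≠ 0 →
      finrank F (LinearMap.ker (B : V →ₗ[F] V →ₗ[F] F)) + 2 * r < finrank F V) :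
    ∃ Z : Submodule F (Dual F (altForms F V)),
      (∀ φ, φ ∈ Z ↔ φ ∈ Y.dualAnnihilator ∧ ∀ i, u i ∈ wedgeRad φ) ∧
      finrank F Z + finrank F Y = (finrank F V - r).choose 2 := by
  obtain ⟨n, hn, e, he⟩ := hu.exists_basis_coord_castAdd_eq
  let ρ : altForms F V →ₗ[F] ({p : Fin n × Fin n // p.1 < p.2} → F) :=
    { toFun B p := (B : V →ₗ[F] V →ₗ[F] F) (e (Fin.natAdd r p.1.1)) (e (Fin.natAdd r p.1.2))
      map_add' B C := by ext; simp
      map_smul' c B := by ext; simp }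
  have hρ_apply (B) (p) : ρ B p =
    (B : V →ₗ[F] V →ₗ[F] F) (e (Fin.natAdd r p.1.1)) (e (Fin.natAdd r p.1.2)) := rfl
  have hρ : Function.Surjective ρ := fun c => by
    refine ⟨∑ p, c p • wedge (e.coord (Fin.natAdd r p.1.1)) (e.coord (Fin.natAdd r p.1.2)), ?_⟩
    ext p
    rw [map_sum, Finset.sum_apply, Finset.sum_eq_single p]
    · rw [map_smul, Pi.smul_apply, hρ_apply, wedge_coord_apply_basis e (by simpa using p.2)
        (by simpa using p.2)]
      simp
    · intro p' _ hp
      rw [map_smul, Pi.smul_apply, hρ_apply, wedge_coord_apply_basis e (by simpa using p'.2)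
        (by simpa using p.2), if_neg, smul_zero]
      simpa [Subtype.ext_iff, Prod.ext_iff] using hp
    · simp
  have hρ_dim : n.choose 2 + finrank F (LinearMap.ker ρ) = finrank F (altForms F V) := by
    have := LinearMap.finrank_range_add_finrank_ker (K := F) (V := altForms F V) ρ
    rwa [LinearMap.range_eq_top.2 hρ, finrank_top, finrank_pi, card_fin_pairs_lt] at this
  have hker : ∀ {φ : Dual F (altForms F V)},
      φ ∈ (LinearMap.ker ρ).dualAnnihilator ↔ ∀ i, u i ∈ wedgeRad φ := fun {φ} => by
    simp only [Submodule.mem_dualAnnihilator, mem_wedgeRad]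
    constructor
    · intro h i v
      refine h _ (LinearMap.mem_ker.2 ?_)
      ext p
      have hne (a : Fin n) : Fin.natAdd r a ≠ Fin.castAdd n i := by
        simp only [ne_eq, Fin.ext_iff, Fin.val_natAdd, Fin.val_castAdd]
        omega
      rw [hρ_apply, wedge_apply, ← he]
      simp [hne]
    · intro h B hB
      rw [altForms_eq_sum_wedge e B, map_sum]
      refine Finset.sum_eq_zero fun p _ => ?_
      rw [map_smul]
      obtain ⟨⟨i, j⟩, hij⟩ := p
      induction i using Fin.addCases with
      | left i => simp [he, h]
      | right i =>
        induction j using Fin.addCases with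
        | left j =>
          simp only [Fin.lt_def, Fin.val_natAdd, Fin.val_castAdd] at hij
          omega
        | right j =>
          have := congr_fun (LinearMap.mem_ker.1 hB) ⟨(i, j), by simpa using hij⟩
          rw [hρ_apply] at this
          simp only at this
          simp [this]
  have hdisj : Y ⊓ LinearMap.ker ρ = ⊥ := by
    refine (Submodule.eq_bot_iff _).2 fun B hB => ?_
    by_contra h0
    have hlt := hY B hB.1 h0
    have hB' (i j : Fin n) :
        (B : V →ₗ[F] V →ₗ[F] F) (e (Fin.natAdd r i)) (e (Fin.natAdd r j)) = 0 := by
      have hρB (p) : ρ B p = 0 := congr_fun (LinearMap.mem_ker.1 hB.2) p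
      rcases lt_trichotomy i j with h | rfl | h
      · exact hρB ⟨(i, j), h⟩
      · exact B.2 _
      · rw [← LinearMap.IsAlt.neg B.2]
        exact neg_eq_zero.2 (hρB ⟨(j, i), h⟩)
    let ψ : V →ₗ[F] (Fin r → F) × (Fin r → F) :=
      (LinearMap.pi u).prod (LinearMap.pi fun i => B.1.flip (e (Fin.castAdd n i)))
    have hψ : LinearMap.ker ψ ≤ LinearMap.ker B.1 := fun x hx => by
      have hx₁ (i) : u i x = 0 := congr_fun (congr_arg Prod.fst (LinearMap.mem_ker.1 hx)) i
      have hx₂ (i) : B.1 x (e (Fin.castAdd n i)) = 0 :=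
        congr_fun (congr_arg Prod.snd (LinearMap.mem_ker.1 hx)) i
      refine e.ext fun j => ?_
      induction j using Fin.addCases with
      | left j => exact hx₂ j
      | right j =>
        have hx₁' (i) : e.repr x (Fin.castAdd n i) = 0 := by
          rw [← e.coord_apply, he, hx₁]
        rw [← e.sum_repr x, Fin.sum_univ_add]
        simp [hx₁', hB']
    have h₁ := ψ.finrank_range_add_finrank_ker
    have h₂ := Submodule.finrank_le (LinearMap.range ψ)
    have h₃ := Submodule.finrank_mono hψ
    rw [finrank_prod, finrank_pi, Fintype.card_fin] at h₂
    omega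
  refine ⟨(Y ⊔ LinearMap.ker ρ).dualAnnihilator, fun φ => ?_, ?_⟩
  · rw [Submodule.dualAnnihilator_sup_eq, Submodule.mem_inf, hker]
  · have h₁ := Subspace.finrank_add_finrank_dualAnnihilator_eq (Y ⊔ LinearMap.ker ρ)
    have h₂ := Submodule.finrank_sup_add_finrank_inf_eq (K := F) (V := altForms F V) Y
      (LinearMap.ker ρ)
    rw [hdisj, finrank_bot] at h₂
    rw [← hn, Nat.add_sub_cancel_left]
    omega

end AlternatingForms

section Moments

variable (q : ℚ)

/-- `∏_{t < r} (X - q ^ t)`: for `X = q ^ d`, the number of linearly independent `r`-tuples in a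
`d`-dimensional space. -/
def frameCount (r : ℕ) (X : ℚ) : ℚ := ∏ t ∈ range r, (X - q ^ t)

/-- `f` is a linear combination of `frameCount q r`, `r ≤ s`, and `v` is the sum of the values of
`f` at the radical sizes of all alternating forms in dimension `M`, normalised by counting the
forms vanishing on given frames. -/
def HasAltMoment (M s : ℕ) (f : ℚ → ℚ) (v : ℚ) : Prop :=
  ∃ c : ℕ → ℚ, (∀ X, f X = ∑ r ∈ range (s + 1), c r * frameCount q r X) ∧
    v = ∑ r ∈ range (s + 1), c r * (frameCount q r (q ^ M) * q ^ ((M - r).choose 2))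

namespace HasAltMoment

variable {q} {M s : ℕ} {f g : ℚ → ℚ} {v w : ℚ}

theorem one : HasAltMoment q M 0 (fun _ => 1) (q ^ (M.choose 2)) :=
  ⟨fun _ => 1, by simp [frameCount], by simp [frameCount]⟩

theorem sub (hf : HasAltMoment q M s f v) (hg : HasAltMoment q M s g w) :
    HasAltMoment q M s (fun X => f X - g X) (v - w) := by
  obtain ⟨c, hc, rfl⟩ := hf
  obtain ⟨d, hd, rfl⟩ := hg
  exact ⟨fun r => c r - d r, fun X => by simp [hc, hd, sub_mul], by simp [sub_mul]⟩

theorem const_mul (a : ℚ) (hf : HasAltMoment q M s f v) :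
    HasAltMoment q M s (fun X => a * f X) (a * v) := by
  obtain ⟨c, hc, rfl⟩ := hf
  exact ⟨fun r => a * c r, fun X => by simp [hc, mul_assoc, mul_sum],
    by simp [mul_assoc, mul_sum]⟩

theorem succ (hf : HasAltMoment q M s f v) : HasAltMoment q M (s + 1) f v := by
  obtain ⟨c, hc, rfl⟩ := hf
  refine ⟨fun r => if r = s + 1 then 0 else c r, fun X => ?_, ?_⟩
  · rw [sum_range_succ, hc]
    simp only [if_true, zero_mul, add_zero]
    exact sum_congr rfl fun r hr => by rw [if_neg (by simp at hr; omega)]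
  · rw [sum_range_succ _ (s + 1)]
    simp only [if_true, zero_mul, add_zero]
    exact sum_congr rfl fun r hr => by rw [if_neg (by simp at hr; omega)]

theorem frameCount_succ (hq : q ≠ 0) (r : ℕ) (X : ℚ) :
    frameCount q (r + 1) X = q ^ r * ((X - 1) * frameCount q r (X / q)) := by
  have : q ^ r * frameCount q r (X / q) = ∏ t ∈ range r, (X - q ^ (t + 1)) := by
    rw [frameCount, ← card_range r, ← prod_const, card_range, ← prod_mul_distrib]
    refine prod_congr rfl fun t _ => ?_
    field_simp
    ring
  rw [frameCount, prod_range_succ', ← this]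
  ring

theorem step (hq : q ≠ 0) (hf : HasAltMoment q M s f v) :
    HasAltMoment q (M + 1) (s + 1) (fun X => (X - 1) * f (X / q)) ((q ^ (M + 1) - 1) * v) := by
  obtain ⟨c, hc, rfl⟩ := hf
  refine ⟨fun r => (q ^ (r - 1))⁻¹ * if r = 0 then 0 else c (r - 1), fun X => ?_, ?_⟩
  · rw [sum_range_succ' _ (s + 1)]
    simp only [hc, frameCount_succ hq, mul_sum]
    simp
    refine sum_congr rfl fun r _ => ?_
    field_simp
  · rw [sum_range_succ' _ (s + 1)]
    simp only [frameCount_succ hq, mul_sum]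
    simp
    refine sum_congr rfl fun r _ => ?_
    rw [pow_succ, mul_div_cancel_right₀ _ hq]
    field_simp

end HasAltMoment

/-- The polynomial vanishing at `q, q ^ 3, …, q ^ (2 * s - 1)`. -/
def oddProd (s : ℕ) (X : ℚ) : ℚ := ∏ t ∈ range s, (X - q ^ (2 * t + 1))

/-- The polynomial vanishing at `1, q ^ 2, …, q ^ (2 * s - 2)`. -/
def evenProd (s : ℕ) (X : ℚ) : ℚ := ∏ t ∈ range s, (X - q ^ (2 * t))

variable {q}

theorem oddProd_eq (hq : q ≠ 0) (s : ℕ) (X : ℚ) :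
    oddProd q s X = q ^ s * evenProd q s (X / q) := by
  rw [oddProd, evenProd, ← card_range s, ← prod_const, card_range, ← prod_mul_distrib]
  refine prod_congr rfl fun t _ => ?_
  field_simp
  ring

theorem evenProd_succ (hq : q ≠ 0) (s : ℕ) (X : ℚ) :
    evenProd q (s + 1) X = q ^ s * ((X - 1) * oddProd q s (X / q)) := by
  have : q ^ s * oddProd q s (X / q) = ∏ t ∈ range s, (X - q ^ (2 * (t + 1))) := by
    rw [oddProd, ← card_range s, ← prod_const, card_range, ← prod_mul_distrib]
    refine prod_congr rfl fun t _ => ?_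
    field_simp
    ring
  rw [evenProd, prod_range_succ', ← this]
  ring

theorem hasAltMoment_oddProd_and_evenProd (hq : q ≠ 0) (s k : ℕ) :
    HasAltMoment q (2 * (s + k) + 1) s (oddProd q s)
      (q ^ ((2 * (s + k) + 1) * k) * oddProd q s (q ^ (2 * (s + k) + 1))) ∧
    HasAltMoment q (2 * (s + k)) s (evenProd q s)
      (q ^ ((2 * (s + k) - 1) * k) * evenProd q s (q ^ (2 * (s + k)))) := by
  induction s generalizing k with
  | zero =>
    constructor
    · convert! HasAltMoment.one (q := q) (M := 2 * (0 + k) + 1) using 1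
      rw [Nat.choose_two_right, show (2 * (0 + k) + 1) * (2 * (0 + k) + 1 - 1)
        = (2 * (0 + k) + 1) * k * 2 by simp; ring, Nat.mul_div_cancel _ two_pos]
      simp [oddProd]
    · convert! HasAltMoment.one (q := q) (M := 2 * (0 + k)) using 1
      rw [Nat.choose_two_right, show (2 * (0 + k)) * (2 * (0 + k) - 1)
        = (2 * (0 + k) - 1) * k * 2 by simp; ring, Nat.mul_div_cancel _ two_pos]
      simp [evenProd]
  | succ s ih =>
    constructor
    · have h₁ := (ih (k + 1)).1.succ.const_mul (q ^ (2 * s + 1) - 1)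
      have h₂ := ((ih (k + 1)).2.step hq).const_mul (q ^ s)
      have h := h₂.sub h₁
      have hM : 2 * (s + (k + 1)) = 2 * (s + 1 + k) := by ring
      rw [hM] at h
      convert h using 1
      · funext X
        rw [oddProd, prod_range_succ, ← oddProd, oddProd_eq hq]
        ring
      · rw [oddProd, prod_range_succ, ← oddProd, oddProd_eq hq,
          pow_succ q (2 * (s + 1 + k)), mul_div_cancel_right₀ _ hq]
        have e : 2 * (s + 1 + k) - 1 = 2 * (s + k) + 1 := by omega
        rw [e]
        ring
    · have h := ((ih k).1.step hq).const_mul (q ^ s)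
      have hM : 2 * (s + k) + 1 + 1 = 2 * (s + 1 + k) := by ring
      rw [hM] at h
      convert h using 1
      · funext X
        rw [evenProd_succ hq]
      · rw [evenProd_succ hq, ← hM, pow_succ q (2 * (s + k) + 1), mul_div_cancel_right₀ _ hq]
        simp only [Nat.add_sub_cancel]
        ring

theorem oddProd_nonneg (hq : 1 ≤ q) (s a : ℕ) : 0 ≤ oddProd q s (q ^ (2 * a + 1)) := by
  rcases lt_or_ge a s with h | h
  · exact (prod_eq_zero (mem_range.2 h) (sub_self _)).ge
  · refine prod_nonneg fun t ht => sub_nonneg.2 (pow_le_pow_right₀ hq ?_)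
    have := mem_range.1 ht
    omega

theorem oddProd_pos (hq : 1 < q) {s a : ℕ} (h : s ≤ a) : 0 < oddProd q s (q ^ (2 * a + 1)) := by
  refine prod_pos fun t ht => sub_pos.2 (pow_lt_pow_right₀ hq ?_)
  have := mem_range.1 ht
  omega

end Moments

section Counting

variable {F V : Type*} [Field F] [Fintype F] [AddCommGroup V] [Module F V] [FiniteDimensional F V]

theorem card_linearIndependent_eq_frameCount (r : ℕ) :
    (Nat.card {u : Fin r → V // LinearIndependent F u} : ℚ) =
      frameCount (Fintype.card F) r ((Fintype.card F : ℚ) ^ finrank F V) := by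
  have hq : 1 ≤ Fintype.card F := Fintype.card_pos
  rcases le_or_gt r (finrank F V) with h | h
  · have : Finite V := Module.finite_of_finite F
    have := Fintype.ofFinite V
    rw [card_linearIndependent h, Nat.cast_prod, frameCount, ← Fin.prod_univ_eq_prod_range
      (fun t => (Fintype.card F : ℚ) ^ finrank F V - (Fintype.card F : ℚ) ^ t)]
    refine prod_congr rfl fun i _ => ?_
    rw [Nat.cast_sub (Nat.pow_le_pow_right hq (by omega))]
    push_cast
    rfl
  · have : IsEmpty {u : Fin r → V // LinearIndependent F u} := ⟨fun u => by
      have := u.2.fintype_card_le_finrank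
      rw [Fintype.card_fin] at this
      omega⟩
    rw [Nat.card_of_isEmpty, frameCount, prod_eq_zero (mem_range.2 h) (sub_self _), Nat.cast_zero]

/-- Linearly independent families in a subspace, as families in the whole space. -/
def linearIndependentSubmoduleEquiv {ι : Type*} (W : Submodule F V) :
    {s : ι → W // LinearIndependent F s} ≃
      {u : {u : ι → V // LinearIndependent F u} // ∀ i, u.1 i ∈ W} where
  toFun s := ⟨⟨fun i => s.1 i, s.2.map' W.subtype W.ker_subtype⟩, fun i => (s.1 i).2⟩
  invFun u := ⟨fun i => ⟨u.1.1 i, u.2 i⟩, LinearIndependent.of_comp W.subtype u.1.2⟩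
  left_inv _ := rfl
  right_inv _ := rfl

theorem sum_frameCount_finrank_wedgeRad [Fintype (Dual F (altForms F V))]
    (Y : Submodule F (altForms F V)) [DecidablePred (· ∈ Y.dualAnnihilator)] {r : ℕ}
    (hY : ∀ B ∈ Y, B ≠ 0 →
      finrank F (LinearMap.ker (B : V →ₗ[F] V →ₗ[F] F)) + 2 * r < finrank F V) :
    (∑ φ : Y.dualAnnihilator, frameCount (Fintype.card F) r
      ((Fintype.card F : ℚ) ^ finrank F (wedgeRad φ.1))) * Nat.card Y =
    frameCount (Fintype.card F) r ((Fintype.card F : ℚ) ^ finrank F V) *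
      (Fintype.card F : ℚ) ^ (finrank F V - r).choose 2 := by
  classical
  have : Finite (Dual F V) := Module.finite_of_finite F
  have := Fintype.ofFinite {u : Fin r → Dual F V // LinearIndependent F u}
  let e : (Σ φ : Y.dualAnnihilator,
        {u : {u : Fin r → Dual F V // LinearIndependent F u} // ∀ i, u.1 i ∈ wedgeRad φ.1}) ≃
      (Σ u : {u : Fin r → Dual F V // LinearIndependent F u},
        {φ : Y.dualAnnihilator // ∀ i, u.1 i ∈ wedgeRad φ.1}) :=
    { toFun x := ⟨x.2.1, x.1, x.2.2⟩
      invFun x := ⟨x.2.1, x.1, x.2.2⟩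
      left_inv _ := rfl
      right_inv _ := rfl }
  have he := Nat.card_congr e
  rw [Nat.card_sigma, Nat.card_sigma] at he
  have hu (u : {u : Fin r → Dual F V // LinearIndependent F u}) :
      Nat.card {φ : Y.dualAnnihilator // ∀ i, u.1 i ∈ wedgeRad φ.1} * Nat.card Y =
        Fintype.card F ^ (finrank F V - r).choose 2 := by
    obtain ⟨Z, hZ, hdim⟩ := finrank_dualAnnihilator_inf_add_finrank u.2 Y hY
    have e' : {φ : Y.dualAnnihilator // ∀ i, u.1 i ∈ wedgeRad φ.1} ≃ Z :=
      (Equiv.subtypeSubtypeEquivSubtypeInter _ fun φ => ∀ i, u.1 i ∈ wedgeRad φ).trans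
        (Equiv.subtypeEquivRight fun φ => (hZ φ).symm)
    rw [Nat.card_congr e', Module.natCard_eq_pow_finrank (K := F) (V := Z),
      Module.natCard_eq_pow_finrank (K := F) (V := Y), ← pow_add, hdim, Nat.card_eq_fintype_card]
  have hφ (φ : Y.dualAnnihilator) : frameCount (Fintype.card F) r
      ((Fintype.card F : ℚ) ^ finrank F (wedgeRad φ.1)) = (Nat.card
        {u : {u : Fin r → Dual F V // LinearIndependent F u} // ∀ i, u.1 i ∈ wedgeRad φ.1} : ℚ) := by
    rw [← Nat.card_congr (linearIndependentSubmoduleEquiv (wedgeRad φ.1))]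
    exact (card_linearIndependent_eq_frameCount (V := wedgeRad φ.1) r).symm
  rw [sum_congr rfl fun φ _ => hφ φ, ← Nat.cast_sum, he, ← Nat.cast_mul, sum_mul,
    sum_congr rfl fun u _ => hu u, sum_const, card_univ, ← Nat.card_eq_fintype_card, smul_eq_mul,
    Nat.cast_mul, card_linearIndependent_eq_frameCount, Subspace.dual_finrank_eq, Nat.cast_pow]

theorem card_le_pow_of_rank_gt {m s : ℕ} (hm : finrank F V = 2 * m + 1) (hs : s ≤ m)
    (Y : Submodule F (altForms F V))
    (hY : ∀ B ∈ Y, B ≠ 0 →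
      finrank F (LinearMap.ker (B : V →ₗ[F] V →ₗ[F] F)) + 2 * s < finrank F V) :
    Nat.card Y ≤ Fintype.card F ^ ((2 * m + 1) * (m - s)) := by
  classical
  have : Finite (Dual F (altForms F V)) := Module.finite_of_finite F
  have := Fintype.ofFinite (Dual F (altForms F V))
  obtain ⟨k, rfl⟩ := Nat.exists_eq_add_of_le hs
  set q : ℚ := ((Fintype.card F : ℕ) : ℚ) with hq_def
  have hq : 1 < q := Nat.one_lt_cast.2 Fintype.one_lt_card
  have hsum : (∑ φ : Y.dualAnnihilator, oddProd q s (q ^ finrank F (wedgeRad φ.1))) * Nat.card Y =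
      q ^ ((2 * (s + k) + 1) * k) * oddProd q s (q ^ (2 * (s + k) + 1)) := by
    obtain ⟨c, hc, hv⟩ := (hasAltMoment_oddProd_and_evenProd (by positivity : q ≠ 0) s k).1
    rw [hv, sum_congr rfl fun φ _ => hc _, sum_comm, sum_mul]
    refine sum_congr rfl fun r hr => ?_
    have hr' := mem_range.1 hr
    rw [← mul_sum, mul_assoc, sum_frameCount_finrank_wedgeRad Y fun B hB h0 =>
      lt_of_le_of_lt (by omega) (hY B hB h0), hm]
  have hpos : 0 < oddProd q s (q ^ (2 * (s + k) + 1)) := oddProd_pos hq hs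
  have hle : oddProd q s (q ^ (2 * (s + k) + 1)) ≤
      ∑ φ : Y.dualAnnihilator, oddProd q s (q ^ finrank F (wedgeRad φ.1)) := by
    have h0 : wedgeRad (0 : Dual F (altForms F V)) = ⊤ := by
      ext u
      simp [mem_wedgeRad]
    refine le_trans (le_of_eq ?_) (single_le_sum (f := fun φ : Y.dualAnnihilator =>
      oddProd q s (q ^ finrank F (wedgeRad φ.1))) (fun φ _ => ?_) (mem_univ 0))
    · simp only [ZeroMemClass.coe_zero]
      rw [(LinearEquiv.ofTop _ h0).finrank_eq, Subspace.dual_finrank_eq, hm]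
    · obtain ⟨l, hl⟩ := exists_finrank_eq_finrank_wedgeRad_add_two_mul φ.1
      have : finrank F (wedgeRad φ.1) = 2 * (s + k - l) + 1 := by omega
      simp only [this]
      exact oddProd_nonneg hq.le _ _
  rw [Nat.add_sub_cancel_left]
  have : (Nat.card Y : ℚ) ≤ q ^ ((2 * (s + k) + 1) * k) := by
    refine le_of_mul_le_mul_right ?_ hpos
    rw [← hsum, mul_comm]
    gcongr
  rw [hq_def] at this
  exact_mod_cast this

end Counting

/-- The Delsarte–Goethals bound: if `Y` is a linear space of alternating
bilinear forms on an `M`-dimensional `F_q`-vector space (`M` odd) and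
`d(Y) = min{rk y : 0 ≠ y ∈ Y}`, then `|Y| ≤ q^{M(M - d(Y) + 1)/2}`.
Here `rk B = M - dim ker B`. -/
theorem delsarte_goethals_bound (Fq : Type*) [Field Fq] [Fintype Fq]
    (V : Type*) [AddCommGroup V] [Module Fq V] [FiniteDimensional Fq V]
    (M : ℕ) (hM : Odd M) (hdim : Module.finrank Fq V = M)
    (Y : Submodule Fq (V →ₗ[Fq] V →ₗ[Fq] Fq))
    (halt : ∀ B ∈ Y, ∀ x, B x x = 0)
    (dY : ℕ)
    (hmin : ∀ B ∈ Y, B ≠ 0 → dY ≤ M - Module.finrank Fq (LinearMap.ker B))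
    (hattained : ∃ B ∈ Y, B ≠ 0 ∧ M - Module.finrank Fq (LinearMap.ker B) = dY) :
    Nat.card Y ≤ (Fintype.card Fq) ^ (M * (M - dY + 1) / 2) := by
  obtain ⟨m, rfl⟩ := hM
  obtain ⟨B₀, hB₀, hne, hrank⟩ := hattained
  obtain ⟨k, hk⟩ := LinearMap.IsAlt.exists_finrank_eq_finrank_ker_add_two_mul (halt B₀ hB₀)
  have hk0 : k ≠ 0 := by
    rintro rfl
    refine hne (LinearMap.ker_eq_top.1 (Submodule.eq_top_of_finrank_eq ?_))
    omega
  have hle : Y ≤ altForms Fq V := fun B hB => halt B hB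
  have h := card_le_pow_of_rank_gt hdim (s := k - 1) (by omega) (Y.comap (altForms Fq V).subtype)
    fun B hB h0 => by
      have := hmin B hB (by simpa using h0)
      omega
  rw [Nat.card_congr (Submodule.comapSubtypeEquivOfLe hle).toEquiv] at h
  have he : 2 * m + 1 - dY + 1 = (m - (k - 1)) * 2 := by omega
  rwa [he, ← mul_assoc, Nat.mul_div_cancel _ two_pos]
end
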